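/- Let n = 2^k with k ≥ 1, let F₂ be the free group of rank 2, R = F₂^{n/2} F₂' and S = R² R'. Then F₂ⁿ F₂'' ≤ S and |F₂/S| = (n/2)² · 2^{1 + n²/4}. Consequently |M(2,n)| ≥ n² · 2^{n²/4 − 1}, where M(2,n) = F₂/(F₂ⁿ F₂''). -/

import Mathlib

/-- The free group on two generators `x = of true`, `y = of false`. -/
abbrev F2 := FreeGroup Bool
/-- The generator `x`. -/
def xx : F2 := FreeGroup.of true
/-- The generator `y`. -/
def yy : F2 := FreeGroup.of false
/-- The subgroup `F₂ⁿ` of `F₂` generated by all `n`-th powers. -/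
def pw (n : ℕ) : Subgroup F2 := Subgroup.closure {g : F2 | ∃ h : F2, h ^ n = g}
/-- The subgroup `Hⁿ` of `F₂` generated by the `n`-th powers of elements of `H`. -/
def pwOf (H : Subgroup F2) (n : ℕ) : Subgroup F2 :=
  Subgroup.closure {g : F2 | ∃ h ∈ H, h ^ n = g}

section Helpers

open scoped commutatorElement

section CocycleCount

variable {A : Type} [AddCommGroup A]

/-- Functions `I(w, a)` on `F₂ × A` which are additive along paths in the Cayley graph of `A`. -/
def Coc (π : F2 →* Multiplicative A) : Submodule (ZMod 2) (F2 → A → ZMod 2) where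
  carrier := {I | ∀ v w a, I (v * w) a = I w a + I v (a + (π w).toAdd)}
  add_mem' := by
    intro I J hI hJ v w a
    simp only [Pi.add_apply]
    rw [hI, hJ]; ring
  zero_mem' := by intro v w a; simp
  smul_mem' := by
    intro c I hI v w a
    simp only [Pi.smul_apply, smul_eq_mul]
    rw [hI]; ring

variable (π : F2 →* Multiplicative A)

theorem Coc.mul {I : F2 → A → ZMod 2} (hI : I ∈ Coc π) (v w : F2) (a : A) :
    I (v * w) a = I w a + I v (a + (π w).toAdd) := hI v w a

theorem Coc.one {I : F2 → A → ZMod 2} (hI : I ∈ Coc π) (a : A) : I 1 a = 0 := by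
  have := Coc.mul π hI 1 1 a
  simpa using this

/-- Restriction of a cocycle to the generators. -/
def Coc.gen : Coc π →ₗ[ZMod 2] (Bool → A → ZMod 2) where
  toFun I := fun b => I.1 (FreeGroup.of b)
  map_add' := by intros; rfl
  map_smul' := by intros; rfl

theorem Coc.gen_injective : Function.Injective (Coc.gen π) := by
  rw [← LinearMap.ker_eq_bot, LinearMap.ker_eq_bot']
  rintro ⟨I, hI⟩ h
  have h1 : ∀ b a, I (FreeGroup.of b) a = 0 := fun b a => congrFun (congrFun h b) a
  apply Subtype.ext
  funext w
  change I w = 0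
  induction w using FreeGroup.induction_on with
  | C1 => funext a; exact Coc.one π hI a
  | of b => funext a; exact h1 b a
  | inv_of b _ =>
    funext a
    have := Coc.mul π hI (FreeGroup.of b) (FreeGroup.of b)⁻¹ a
    rw [mul_inv_cancel, Coc.one π hI, h1, add_zero] at this
    exact this.symm
  | mul v w hv hw =>
    funext a
    rw [Coc.mul π hI, hv, hw]; simp

/-- The permutation of `A × ℤ/2` attached to a generator. -/
def genPerm (e : Bool → A → ZMod 2) (b : Bool) : Equiv.Perm (A × ZMod 2) where
  toFun p := (p.1 + (π (FreeGroup.of b)).toAdd, p.2 + e b p.1)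
  invFun p := (p.1 - (π (FreeGroup.of b)).toAdd, p.2 - e b (p.1 - (π (FreeGroup.of b)).toAdd))
  left_inv := by intro p; simp
  right_inv := by intro p; simp

theorem genPerm_lift (e : Bool → A → ZMod 2) (w : F2) : ∀ (a : A) (z : ZMod 2),
    FreeGroup.lift (genPerm π e) w (a, z) =
      (a + (π w).toAdd, z + (FreeGroup.lift (genPerm π e) w (a, 0)).2) := by
  induction w using FreeGroup.induction_on with
  | C1 => intro a z; simp
  | of b => intro a z; simp [genPerm]
  | inv_of b _ =>
    intro a z
    simp [genPerm, Equiv.Perm.inv_def, Equiv.symm, sub_eq_add_neg]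
  | mul v w hv hw =>
    intro a z
    simp only [map_mul, Equiv.Perm.mul_apply, toAdd_mul]
    rw [hw a z, hv, hw a 0, hv _ (0 + _)]
    ext
    · simp only [add_assoc]; abel_nf
    · simp only; ring

theorem Coc.gen_surjective : Function.Surjective (Coc.gen π) := by
  intro e
  refine ⟨⟨fun w a => (FreeGroup.lift (genPerm π e) w (a, 0)).2, ?_⟩, ?_⟩
  · intro v w a
    simp only [map_mul, Equiv.Perm.mul_apply]
    rw [genPerm_lift π e w a 0, genPerm_lift π e v]
  · funext b a
    simp [Coc.gen, genPerm]

variable (R : Subgroup F2)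

/-- A cocycle restricts to a homomorphism on `R`. -/
def Coc.res (hR : ∀ w, w ∈ R ↔ (π w).toAdd = 0) :
    Coc π →ₗ[ZMod 2] (Additive R →+ ZMod 2) where
  toFun I :=
    { toFun := fun r => I.1 (r.toMul : R) 0
      map_zero' := Coc.one π I.2 0
      map_add' := by
        intro r s
        have := Coc.mul π I.2 (r.toMul : R) (s.toMul : R) 0
        rw [(hR _).1 (s.toMul : R).2] at this
        simp only [toMul_add, Subgroup.coe_mul]
        rw [this, add_zero, add_comm] }
  map_add' := by intros; rfl
  map_smul' := by intros; rfl

/-- The coboundary map. -/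
def Coc.bd : (A → ZMod 2) →ₗ[ZMod 2] Coc π where
  toFun f := ⟨fun w a => f (a + (π w).toAdd) - f a, by
    intro v w a
    simp only [map_mul, toAdd_mul]
    rw [show a + ((π v).toAdd + (π w).toAdd) = a + (π w).toAdd + (π v).toAdd by abel]
    ring⟩
  map_add' := by
    intro f g; apply Subtype.ext; funext w a; simp; ring
  map_smul' := by
    intro c g; apply Subtype.ext; funext w a; simp; ring

theorem Coc.range_bd (hR : ∀ w, w ∈ R ↔ (π w).toAdd = 0)
    (hπ : Function.Surjective π) :
    LinearMap.range (Coc.bd π) = LinearMap.ker (Coc.res π R hR) := by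
  apply le_antisymm
  · rintro _ ⟨f, rfl⟩
    rw [LinearMap.mem_ker]
    ext r
    change f (0 + (π (r : F2)).toAdd) - f 0 = 0
    rw [(hR _).1 r.2]; simp
  · rintro ⟨I, hI⟩ h
    rw [LinearMap.mem_ker] at h
    have h0 : ∀ r, r ∈ R → I r 0 = 0 := fun r hr =>
      DFunLike.congr_fun h (Additive.ofMul (⟨r, hr⟩ : R))
    choose t ht using fun a : A => hπ (Multiplicative.ofAdd a)
    have hwd : ∀ v w, (π v).toAdd = (π w).toAdd → I v 0 = I w 0 := by
      intro v w hvw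
      have hr : w⁻¹ * v ∈ R := by
        rw [hR]; simp [hvw]
      have := Coc.mul π hI w (w⁻¹ * v) 0
      rw [h0 _ hr, (hR _).1 hr] at this
      simpa using this
    refine ⟨fun a => I (t a) 0, ?_⟩
    apply Subtype.ext
    funext w a
    change I (t (a + (π w).toAdd)) 0 - I (t a) 0 = I w a
    rw [hwd (t (a + (π w).toAdd)) (w * t a) (by simp [ht, add_comm]), Coc.mul π hI]
    simp [ht]

theorem Coc.res_surjective (hR : ∀ w, w ∈ R ↔ (π w).toAdd = 0)
    (hπ : Function.Surjective π) :
    Function.Surjective (Coc.res π R hR) := by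
  classical
  intro φ
  choose t0 ht0 using fun a : A => hπ (Multiplicative.ofAdd a)
  obtain ⟨t, ht, ht1⟩ : ∃ t : A → F2, (∀ a, π (t a) = Multiplicative.ofAdd a) ∧ t 0 = 1 := by
    refine ⟨fun a => if a = 0 then 1 else t0 a, ?_, by simp⟩
    intro a
    by_cases h : a = 0
    · simp [h]
    · simp [h, ht0]
  have hm : ∀ w a, (t (a + (π w).toAdd))⁻¹ * w * t a ∈ R := by
    intro w a
    rw [hR]; simp [ht]
  refine ⟨⟨fun w a => φ (Additive.ofMul (⟨_, hm w a⟩ : R)), ?_⟩, ?_⟩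
  · intro v w a
    simp only
    rw [add_comm (φ _) (φ _), ← map_add, ← ofMul_mul]
    congr 2
    apply Subtype.ext
    simp only [Subgroup.coe_mul, map_mul, toAdd_mul]
    rw [show a + ((π v).toAdd + (π w).toAdd) = a + (π w).toAdd + (π v).toAdd by abel]
    group
  · ext r
    change φ (Additive.ofMul _) = φ (Additive.ofMul r)
    congr 2
    apply Subtype.ext
    have : (π (r : F2)).toAdd = 0 := (hR _).1 r.2
    simp [this, ht1]

theorem Coc.finrank_ker_bd (hπ : Function.Surjective π) :
    Module.finrank (ZMod 2) (LinearMap.ker (Coc.bd π)) = 1 := by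
  have : LinearMap.ker (Coc.bd π) = Submodule.span (ZMod 2) {(fun _ => 1 : A → ZMod 2)} := by
    ext f
    rw [LinearMap.mem_ker, Submodule.mem_span_singleton]
    constructor
    · intro h
      refine ⟨f 0, ?_⟩
      funext a
      obtain ⟨w, hw⟩ := hπ (Multiplicative.ofAdd a)
      have h1 : f (0 + (π w).toAdd) - f 0 = 0 :=
        congrFun (congrFun (congrArg Subtype.val h) w) 0
      rw [hw] at h1
      simp only [toAdd_ofAdd, zero_add] at h1
      simp [sub_eq_zero.1 h1]
    · rintro ⟨c, rfl⟩
      apply Subtype.ext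
      funext w a
      simp [Coc.bd]
  rw [this, finrank_span_singleton]
  intro h
  have := congrFun h 0
  simp at this

theorem Coc.finite_hom [Finite A] (hR : ∀ w, w ∈ R ↔ (π w).toAdd = 0)
    (hπ : Function.Surjective π) :
    Module.Finite (ZMod 2) (Additive R →+ ZMod 2) := by
  have : Module.Finite (ZMod 2) (Coc π) :=
    Module.Finite.of_injective _ (Coc.gen_injective π)
  exact Module.Finite.of_surjective _ (Coc.res_surjective π R hR hπ)

theorem Coc.finrank_hom [Finite A] (hR : ∀ w, w ∈ R ↔ (π w).toAdd = 0)
    (hπ : Function.Surjective π) :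
    Module.finrank (ZMod 2) (Additive R →+ ZMod 2) = 1 + Nat.card A := by
  have := Fintype.ofFinite A
  have hf : Module.Finite (ZMod 2) (Coc π) :=
    Module.Finite.of_injective _ (Coc.gen_injective π)
  have h1 := (LinearEquiv.ofBijective (Coc.gen π)
    ⟨Coc.gen_injective π, Coc.gen_surjective π⟩).finrank_eq
  have h2 := LinearMap.finrank_range_add_finrank_ker (Coc.res π R hR)
  have h3 := LinearMap.finrank_range_add_finrank_ker (Coc.bd π)
  rw [Coc.finrank_ker_bd π hπ, Coc.range_bd π R hR hπ] at h3
  rw [LinearMap.range_eq_top.2 (Coc.res_surjective π R hR hπ), finrank_top] at h2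
  simp [Module.finrank_pi_fintype] at h1 h3
  rw [Nat.card_eq_fintype_card]
  omega

end CocycleCount

theorem card_quot_eq {G : Type} [Group G] (T : Subgroup G) [T.Normal] (h1 : ∀ g, g ^ 2 ∈ T)
    (h2 : commutator G ≤ T) (h3 : ∀ φ : G →* Multiplicative (ZMod 2), T ≤ φ.ker)
    (hf : Module.Finite (ZMod 2) (Additive G →+ ZMod 2)) :
    Nat.card (G ⧸ T) = 2 ^ Module.finrank (ZMod 2) (Additive G →+ ZMod 2) := by
  let _ : CommGroup (G ⧸ T) :=
    { (inferInstance : Group (G ⧸ T)) with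
      mul_comm := by
        intro a b
        induction a using QuotientGroup.induction_on with | H a => ?_
        induction b using QuotientGroup.induction_on with | H b => ?_
        rw [← QuotientGroup.mk_mul, ← QuotientGroup.mk_mul, QuotientGroup.eq]
        apply h2
        have : (a * b)⁻¹ * (b * a) = ⁅b⁻¹, a⁻¹⁆ := by
          rw [commutatorElement_def]; group
        rw [this]
        exact Subgroup.commutator_mem_commutator (Subgroup.mem_top _) (Subgroup.mem_top _) }
  let _ : Module (ZMod 2) (Additive (G ⧸ T)) := AddCommGroup.zmodModule (by
    intro x
    apply Additive.toMul.injective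
    rw [toMul_nsmul, toMul_zero]
    generalize x.toMul = y
    induction y using QuotientGroup.induction_on with | H a => ?_
    rw [← QuotientGroup.mk_pow, QuotientGroup.eq_one_iff]
    exact h1 a)
  let f : Module.Dual (ZMod 2) (Additive (G ⧸ T)) →ₗ[ZMod 2] (Additive G →+ ZMod 2) :=
    { toFun := fun ψ => ψ.toAddMonoidHom.comp (MonoidHom.toAdditive (QuotientGroup.mk' T))
      map_add' := by intros; rfl
      map_smul' := by intros; rfl }
  have hinj : Function.Injective f := by
    intro ψ χ h
    ext x
    obtain ⟨g, hg⟩ := QuotientGroup.mk'_surjective T x.toMul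
    have := DFunLike.congr_fun h (Additive.ofMul g)
    change ψ (Additive.ofMul (QuotientGroup.mk' T g)) =
      χ (Additive.ofMul (QuotientGroup.mk' T g)) at this
    rw [hg] at this
    exact this
  have hsurj : Function.Surjective f := by
    intro φ
    let φm : G →* Multiplicative (ZMod 2) := AddMonoidHom.toMultiplicativeRight φ
    let q := QuotientGroup.lift T φm (h3 φm)
    let qadd : Additive (G ⧸ T) →+ ZMod 2 := MonoidHom.toAdditiveLeft q
    exact ⟨qadd.toZModLinearMap 2, by ext x; rfl⟩
  have he := (LinearEquiv.ofBijective f ⟨hinj, hsurj⟩)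
  have hfd : Module.Finite (ZMod 2) (Module.Dual (ZMod 2) (Additive (G ⧸ T))) :=
    Module.Finite.equiv he.symm
  have hfq : Module.Finite (ZMod 2) (Additive (G ⧸ T)) :=
    Module.finite_dual_iff (ZMod 2) |>.1 hfd
  rw [← he.finrank_eq, Subspace.dual_finrank_eq]
  have := Module.natCard_eq_pow_finrank (K := ZMod 2) (V := Additive (G ⧸ T))
  rw [Nat.card_zmod] at this
  exact this

/-- The exponent-sum map to `(ℤ/m)²`. -/
def expMap (m : ℕ) : F2 →* Multiplicative (ZMod m × ZMod m) :=
  FreeGroup.lift fun b => Multiplicative.ofAdd (if b then (1, 0) else (0, 1))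

theorem expMap_surjective (m : ℕ) : Function.Surjective (expMap m) := by
  intro a
  obtain ⟨i, hi⟩ := ZMod.intCast_surjective a.toAdd.1
  obtain ⟨j, hj⟩ := ZMod.intCast_surjective a.toAdd.2
  refine ⟨xx ^ i * yy ^ j, ?_⟩
  apply Multiplicative.toAdd.injective
  ext <;> simp [expMap, xx, yy, hi, hj]

instance pw_normal (m : ℕ) : (pw m).Normal := by
  constructor
  intro x hx g
  have : pw m ≤ (pw m).comap (MulAut.conj g).toMonoidHom := by
    conv_lhs => rw [pw]
    rw [Subgroup.closure_le]
    rintro _ ⟨h, rfl⟩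
    apply Subgroup.subset_closure
    exact ⟨MulAut.conj g h, by simp⟩
  exact this hx

theorem pwOf_normal (H : Subgroup F2) [hH : H.Normal] (m : ℕ) : (pwOf H m).Normal := by
  constructor
  intro x hx g
  have : pwOf H m ≤ (pwOf H m).comap (MulAut.conj g).toMonoidHom := by
    conv_lhs => rw [pwOf]
    rw [Subgroup.closure_le]
    rintro _ ⟨h, hh, rfl⟩
    apply Subgroup.subset_closure
    exact ⟨MulAut.conj g h, hH.conj_mem h hh g, by simp⟩
  exact this hx

theorem ker_expMap (m : ℕ) : (expMap m).ker = pw m ⊔ commutator F2 := by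
  apply le_antisymm
  · intro w hw
    let N := pw m ⊔ commutator F2
    have hN : N.Normal := by infer_instance
    let _ : CommGroup (F2 ⧸ N) :=
      { (inferInstance : Group (F2 ⧸ N)) with
        mul_comm := by
          intro a b
          induction a using QuotientGroup.induction_on with | H a => ?_
          induction b using QuotientGroup.induction_on with | H b => ?_
          rw [← QuotientGroup.mk_mul, ← QuotientGroup.mk_mul, QuotientGroup.eq]
          apply Subgroup.mem_sup_right
          have : (a * b)⁻¹ * (b * a) = ⁅b⁻¹, a⁻¹⁆ := by
            rw [commutatorElement_def]; group
          rw [this]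
          exact Subgroup.commutator_mem_commutator (Subgroup.mem_top _) (Subgroup.mem_top _) }
    let α : F2 →* Multiplicative ℤ :=
      FreeGroup.lift fun b => Multiplicative.ofAdd (if b then 1 else 0)
    let β : F2 →* Multiplicative ℤ :=
      FreeGroup.lift fun b => Multiplicative.ofAdd (if b then 0 else 1)
    let γ : F2 →* F2 ⧸ N :=
      (zpowersHom (F2 ⧸ N) (QuotientGroup.mk' N xx)).comp α *
        (zpowersHom (F2 ⧸ N) (QuotientGroup.mk' N yy)).comp β
    have hγ : QuotientGroup.mk' N = γ := by
      apply FreeGroup.ext_hom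
      intro b
      cases b <;> simp [γ, α, β, xx, yy]
    have hexp : ∀ v, (expMap m v).toAdd = (((α v).toAdd : ZMod m), ((β v).toAdd : ZMod m)) := by
      intro v
      induction v using FreeGroup.induction_on with
      | C1 => simp; rfl
      | of b => cases b <;> simp [α, β, expMap]
      | inv_of b h => simp [h]
      | mul v w hv hw => simp [hv, hw]
    have hwz : (expMap m w).toAdd = 0 := by
      rw [MonoidHom.mem_ker] at hw; rw [hw]; rfl
    rw [hexp, Prod.mk_eq_zero, ZMod.intCast_zmod_eq_zero_iff_dvd,
      ZMod.intCast_zmod_eq_zero_iff_dvd] at hwz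
    obtain ⟨⟨i, hi⟩, j, hj⟩ := hwz
    have hp : ∀ v, (QuotientGroup.mk' N v) ^ m = 1 := by
      intro v
      rw [← map_pow, QuotientGroup.mk'_apply, QuotientGroup.eq_one_iff]
      exact Subgroup.mem_sup_left (Subgroup.subset_closure ⟨v, rfl⟩)
    have : QuotientGroup.mk' N w = 1 := by
      rw [hγ]
      simp only [γ, MonoidHom.mul_apply, MonoidHom.comp_apply, zpowersHom_apply]
      rw [hi, hj, zpow_mul, zpow_mul, zpow_natCast, zpow_natCast, hp, hp]
      simp
    rwa [QuotientGroup.mk'_apply, QuotientGroup.eq_one_iff] at this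
  · rw [sup_le_iff]
    constructor
    · rw [pw, Subgroup.closure_le]
      rintro _ ⟨h, rfl⟩
      rw [SetLike.mem_coe, MonoidHom.mem_ker, map_pow]
      apply Multiplicative.toAdd.injective
      ext <;> simp
    · exact Abelianization.commutator_subset_ker _

theorem index_R (m : ℕ) : (pw m ⊔ commutator F2).index = m ^ 2 := by
  rw [← ker_expMap, Subgroup.index_ker, MonoidHom.range_eq_top.2 (expMap_surjective m),
    Subgroup.card_top]
  change Nat.card (ZMod m × ZMod m) = _
  rw [Nat.card_prod, Nat.card_zmod, sq]

theorem index_S (m : ℕ) (hm : m ≠ 0) :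
    (pwOf (pw m ⊔ commutator F2) 2 ⊔
      ⁅pw m ⊔ commutator F2, pw m ⊔ commutator F2⁆).index = m ^ 2 * 2 ^ (1 + m ^ 2) := by
  have : NeZero m := ⟨hm⟩
  have hi := index_R m
  have hmem : ∀ w, w ∈ pw m ⊔ commutator F2 ↔ (expMap m w).toAdd = 0 := by
    intro w
    rw [← ker_expMap, MonoidHom.mem_ker]; rfl
  have hn : (pw m ⊔ commutator F2).Normal := inferInstance
  generalize pw m ⊔ commutator F2 = R at *
  have hnp := pwOf_normal R 2
  have hSn : (pwOf R 2 ⊔ ⁅R, R⁆).Normal := inferInstance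
  have hSR : pwOf R 2 ⊔ ⁅R, R⁆ ≤ R := by
    rw [sup_le_iff]
    constructor
    · rw [pwOf, Subgroup.closure_le]
      rintro _ ⟨h, hh, rfl⟩
      exact R.pow_mem hh 2
    · exact Subgroup.commutator_le_left R R
  rw [← Subgroup.relIndex_mul_index hSR, hi, mul_comm]
  congr 1
  rw [Subgroup.relIndex, Subgroup.index]
  rw [card_quot_eq, Coc.finrank_hom (expMap m) R hmem (expMap_surjective m), Nat.card_prod,
    Nat.card_zmod, sq]
  · intro g
    rw [Subgroup.mem_subgroupOf]
    exact Subgroup.mem_sup_left (Subgroup.subset_closure ⟨g, g.2, rfl⟩)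
  · rw [commutator_def, Subgroup.commutator_le]
    intro a _ b _
    rw [Subgroup.mem_subgroupOf]
    exact Subgroup.mem_sup_right (Subgroup.commutator_mem_commutator a.2 b.2)
  · intro φ
    have : pwOf R 2 ⊔ ⁅R, R⁆ ≤ φ.ker.map R.subtype := by
      rw [sup_le_iff]
      constructor
      · rw [pwOf, Subgroup.closure_le]
        rintro _ ⟨h, hh, rfl⟩
        refine ⟨(⟨h, hh⟩ : R) ^ 2, ?_, rfl⟩
        rw [SetLike.mem_coe, MonoidHom.mem_ker, map_pow]
        generalize φ _ = z
        revert z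
        change ∀ z : ZMod 2, 2 • z = 0
        decide
      · rw [Subgroup.commutator_le]
        intro a ha b hb
        refine ⟨⁅(⟨a, ha⟩ : R), (⟨b, hb⟩ : R)⁆, ?_, rfl⟩
        exact Abelianization.commutator_subset_ker φ
          (Subgroup.commutator_mem_commutator (Subgroup.mem_top _) (Subgroup.mem_top _))
    intro r hr
    obtain ⟨s, hs, hsr⟩ := this (Subgroup.mem_subgroupOf.1 hr)
    have : s = r := Subtype.ext hsr
    rwa [← this]
  · exact Coc.finite_hom (expMap m) R hmem (expMap_surjective m)

theorem finite_M (n : ℕ) (hn : n ≠ 0) :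
    (pw n ⊔ ⁅commutator F2, commutator F2⁆).index ≠ 0 := by
  set N := pw n ⊔ ⁅commutator F2, commutator F2⁆ with hN
  have hNn : N.Normal := inferInstance
  set R := pw n ⊔ commutator F2 with hR
  have hRi : R.index ≠ 0 := by rw [hR, index_R]; positivity
  have hNR : N ≤ R := sup_le_sup_left (Subgroup.commutator_le_left _ _) _
  have : R.FiniteIndex := ⟨hRi⟩
  have hfg : Group.FG R := inferInstance
  rw [← Subgroup.relIndex_mul_index hNR]
  refine mul_ne_zero ?_ hRi
  let T := N.subgroupOf R
  have hT : T.Normal := inferInstance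
  have hrep : ∀ r : R, ∃ c : R, (c : F2) ∈ commutator F2 ∧ (r : R ⧸ T) = c := by
    rintro ⟨r, hr⟩
    obtain ⟨p, hp, c, hc, rfl⟩ := Subgroup.mem_sup_of_normal_left.1 hr
    refine ⟨⟨c, Subgroup.mem_sup_right hc⟩, hc, ?_⟩
    rw [eq_comm, QuotientGroup.eq, Subgroup.mem_subgroupOf]
    apply Subgroup.mem_sup_left
    have := (pw_normal n).conj_mem p hp c⁻¹
    simpa [mul_assoc] using this
  let _ : CommGroup (R ⧸ T) :=
    { (inferInstance : Group (R ⧸ T)) with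
      mul_comm := by
        intro a b
        induction a using QuotientGroup.induction_on with | H a => ?_
        induction b using QuotientGroup.induction_on with | H b => ?_
        obtain ⟨a, ha, hrepa⟩ := hrep a
        obtain ⟨b, hb, hrepb⟩ := hrep b
        rw [hrepa, hrepb]
        rw [← QuotientGroup.mk_mul, ← QuotientGroup.mk_mul, QuotientGroup.eq]
        have : (a * b)⁻¹ * (b * a) = ⁅b⁻¹, a⁻¹⁆ := by
          rw [commutatorElement_def]; group
        rw [this, Subgroup.mem_subgroupOf]
        exact Subgroup.mem_sup_right
          (Subgroup.commutator_mem_commutator (Subgroup.inv_mem _ hb) (Subgroup.inv_mem _ ha)) }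
  have hfin : Finite (R ⧸ T) := by
    have : Group.FG (R ⧸ T) := inferInstance
    apply CommGroup.finite_of_fg_isMulTorsion
    intro x
    rw [isOfFinOrder_iff_pow_eq_one]
    refine ⟨n, Nat.pos_of_ne_zero hn, ?_⟩
    induction x using QuotientGroup.induction_on with | H a => ?_
    rw [← QuotientGroup.mk_pow, QuotientGroup.eq_one_iff, Subgroup.mem_subgroupOf]
    exact Subgroup.mem_sup_left (Subgroup.subset_closure ⟨a, rfl⟩)
  exact Subgroup.index_ne_zero_of_finite (H := T)

end Helpers

/-- For `n = 2^k`, with `R = F₂^{n/2}F₂'` and `S = R²R'`, one has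
`F₂ⁿF₂'' ≤ S` and `|F₂/S| = (n/2)²·2^{1+n²/4}`; consequently
`|M(2,n)| = |F₂/(F₂ⁿF₂'')| ≥ n²·2^{n²/4 - 1}`. -/
theorem metabelian_lower_bound_newman (k : ℕ) (hk : 1 ≤ k) :
    pw (2 ^ k) ⊔ ⁅commutator F2, commutator F2⁆ ≤
      pwOf (pw (2 ^ (k - 1)) ⊔ commutator F2) 2 ⊔
        ⁅pw (2 ^ (k - 1)) ⊔ commutator F2, pw (2 ^ (k - 1)) ⊔ commutator F2⁆ ∧
    Nat.card (F2 ⧸ (pwOf (pw (2 ^ (k - 1)) ⊔ commutator F2) 2 ⊔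
        ⁅pw (2 ^ (k - 1)) ⊔ commutator F2, pw (2 ^ (k - 1)) ⊔ commutator F2⁆)) =
      (2 ^ (k - 1)) ^ 2 * 2 ^ (1 + (2 ^ (k - 1)) ^ 2) ∧
    Nat.card (F2 ⧸ (pw (2 ^ k) ⊔ ⁅commutator F2, commutator F2⁆)) ≥
      (2 ^ k) ^ 2 * 2 ^ ((2 ^ (k - 1)) ^ 2 - 1) := by
  have hle : pw (2 ^ k) ⊔ ⁅commutator F2, commutator F2⁆ ≤
      pwOf (pw (2 ^ (k - 1)) ⊔ commutator F2) 2 ⊔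
        ⁅pw (2 ^ (k - 1)) ⊔ commutator F2, pw (2 ^ (k - 1)) ⊔ commutator F2⁆ := by
    apply sup_le_sup
    · conv_lhs => rw [pw]
      rw [Subgroup.closure_le]
      rintro _ ⟨h, rfl⟩
      refine Subgroup.subset_closure ⟨h ^ (2 ^ (k - 1)), ?_, ?_⟩
      · exact Subgroup.mem_sup_left (Subgroup.subset_closure ⟨h, rfl⟩)
      · rw [← pow_mul, ← pow_succ, Nat.sub_add_cancel hk]
    · exact Subgroup.commutator_mono le_sup_right le_sup_right
  have hS := index_S (2 ^ (k - 1)) (by positivity)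
  refine ⟨hle, hS, ?_⟩
  have h1 : (2 ^ k) ^ 2 * 2 ^ ((2 ^ (k - 1)) ^ 2 - 1) =
      (2 ^ (k - 1)) ^ 2 * 2 ^ (1 + (2 ^ (k - 1)) ^ 2) := by
    obtain ⟨j, rfl⟩ : ∃ j, k = j + 1 := ⟨k - 1, by omega⟩
    simp only [Nat.add_sub_cancel]
    obtain ⟨q, hq⟩ : ∃ q, (2 ^ j) ^ 2 = q + 1 := ⟨(2 ^ j) ^ 2 - 1, by
      have : 0 < (2 ^ j) ^ 2 := by positivity
      omega⟩
    rw [pow_succ 2 j, mul_pow, hq]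
    simp only [Nat.add_sub_cancel]
    ring
  rw [h1, ← hS]
  exact Nat.le_of_dvd (Nat.pos_of_ne_zero (finite_M (2 ^ k) (by positivity)))
    (Subgroup.index_dvd_of_le hle)
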